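/- arXiv:1905.13599 — 4 statements merged into one kernel-verified Lean document; each statement's English description precedes it below -/
import Mathlib

section
/- Let X and Y be measurable spaces and K a Markov kernel from X to Y. Suppose δ ∈ [0,1] is such that dTV(K x, K x') ≤ δ for all x, x' ∈ X. Then for all probability measures μ and ν on X one has dTV(μ.bind K, ν.bind K) ≤ δ · dTV(μ, ν), where μ.bind K is the measure A ↦ ∫ K(x)(A) dμ(x). In particular the map ν ↦ ν.bind K is always 1-Lipschitz for dTV, and is a strict contraction whenever δ < 1. -/
open MeasureTheory ProbabilityTheory

/-- Total variation distance between two measures: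
`dTV μ ν = sup over measurable sets A of |μ(A) − ν(A)|`. -/
noncomputable def dTV {X : Type*} [MeasurableSpace X] (μ ν : Measure X) : ℝ :=
  ⨆ A : {A : Set X // MeasurableSet A}, |(μ A.1).toReal - (ν A.1).toReal|

lemma bddAbove_dTV {X : Type*} [MeasurableSpace X] (μ ν : Measure X)
    [IsProbabilityMeasure μ] [IsProbabilityMeasure ν] :
    BddAbove (Set.range fun A : {A : Set X // MeasurableSet A} =>
      |(μ A.1).toReal - (ν A.1).toReal|) := by
  refine ⟨1, ?_⟩
  rintro _ ⟨A, rfl⟩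
  have h₁ : μ.real A.1 ≤ 1 := measureReal_le_one
  have h₂ : ν.real A.1 ≤ 1 := measureReal_le_one
  have h₃ : 0 ≤ μ.real A.1 := measureReal_nonneg
  have h₄ : 0 ≤ ν.real A.1 := measureReal_nonneg
  change |μ.real A.1 - ν.real A.1| ≤ 1
  rw [abs_le]
  constructor <;> linarith

lemma abs_measureReal_sub_le_dTV {X : Type*} [MeasurableSpace X] (μ ν : Measure X)
    [IsProbabilityMeasure μ] [IsProbabilityMeasure ν] {A : Set X} (hA : MeasurableSet A) :
    |μ.real A - ν.real A| ≤ dTV μ ν :=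
  le_ciSup (bddAbove_dTV μ ν) ⟨A, hA⟩

lemma integrableOn_Ioc_measureReal_le {X : Type*} [MeasurableSpace X] (μ : Measure X)
    [IsFiniteMeasure μ] (f : X → ℝ) (a b : ℝ) :
    IntegrableOn (fun t => μ.real {x | t ≤ f x}) (Set.Ioc a b) := by
  have hanti : Antitone fun t => μ.real {x | t ≤ f x} :=
    fun s t hst => measureReal_mono fun x hx => hst.trans hx
  exact ((hanti.antitoneOn _).integrableOn_isCompact isCompact_Icc).mono_set Set.Ioc_subset_Icc_self

/-- The integrals of a function with values in `[0, δ]` differ by at most `δ` times the total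
variation distance. -/
lemma abs_integral_sub_le_mul_dTV {X : Type*} [MeasurableSpace X] (μ ν : Measure X)
    [IsProbabilityMeasure μ] [IsProbabilityMeasure ν] {f : X → ℝ} (hf : Measurable f)
    {δ : ℝ} (hf0 : ∀ x, 0 ≤ f x) (hfδ : ∀ x, f x ≤ δ) (hδ : 0 ≤ δ) :
    |∫ x, f x ∂μ - ∫ x, f x ∂ν| ≤ δ * dTV μ ν := by
  have layercake (ρ : Measure X) [IsProbabilityMeasure ρ] :
      ∫ x, f x ∂ρ = ∫ t in Set.Ioc 0 δ, ρ.real {x | t ≤ f x} := by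
    have hint : Integrable f ρ :=
      Integrable.of_bound hf.aestronglyMeasurable δ
        (.of_forall fun x => by simpa [abs_of_nonneg (hf0 x)] using hfδ x)
    exact hint.integral_eq_integral_Ioc_meas_le (.of_forall hf0) (.of_forall hfδ)
  rw [layercake μ, layercake ν, ← integral_sub (integrableOn_Ioc_measureReal_le μ f 0 δ)
    (integrableOn_Ioc_measureReal_le ν f 0 δ), ← Real.norm_eq_abs]
  refine (norm_setIntegral_le_of_norm_le_const (C := dTV μ ν) (by simp) fun t _ =>
    abs_measureReal_sub_le_dTV μ ν (measurableSet_le measurable_const hf)).trans_eq ?_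
  simp [hδ, mul_comm]

/-- The integrals of a function of oscillation at most `δ` differ by at most `δ` times the total
variation distance. -/
lemma abs_integral_sub_le_mul_dTV_of_osc_le {X : Type*} [MeasurableSpace X] (μ ν : Measure X)
    [IsProbabilityMeasure μ] [IsProbabilityMeasure ν] {f : X → ℝ} (hf : Measurable f)
    {δ : ℝ} (hosc : ∀ x x', f x - f x' ≤ δ) (hδ : 0 ≤ δ) :
    |∫ x, f x ∂μ - ∫ x, f x ∂ν| ≤ δ * dTV μ ν := by
  obtain ⟨x₀⟩ := nonempty_of_isProbabilityMeasure μ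
  have : Nonempty X := ⟨x₀⟩
  have hbdd : BddBelow (Set.range f) := by
    refine ⟨f x₀ - δ, ?_⟩
    rintro _ ⟨x, rfl⟩
    linarith [hosc x₀ x]
  have hlow (x : X) : ⨅ y, f y ≤ f x := ciInf_le hbdd x
  have hup (x : X) : f x - δ ≤ ⨅ y, f y := le_ciInf fun y => by linarith [hosc x y]
  have hint (ρ : Measure X) [IsProbabilityMeasure ρ] : Integrable f ρ :=
    Integrable.of_mem_Icc (⨅ y, f y) ((⨅ y, f y) + δ) hf.aemeasurable
      (.of_forall fun x => ⟨hlow x, by linarith [hup x]⟩)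
  have h := abs_integral_sub_le_mul_dTV μ ν (hf.sub_const (⨅ y, f y))
    (fun x => sub_nonneg.2 (hlow x)) (fun x => by linarith [hup x]) hδ
  rw [integral_sub (hint μ) (integrable_const _), integral_sub (hint ν) (integrable_const _)] at h
  simpa using h

lemma measureReal_bind_kernel {X Y : Type*} [MeasurableSpace X] [MeasurableSpace Y]
    (K : Kernel X Y) [IsMarkovKernel K] (μ : Measure X) {A : Set Y} (hA : MeasurableSet A) :
    (μ.bind (fun x => K x)).real A = ∫ x, (K x).real A ∂μ := by
  rw [measureReal_def, Measure.bind_apply hA K.measurable.aemeasurable]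
  exact (integral_toReal (K.measurable_coe hA).aemeasurable
    (.of_forall fun x => measure_lt_top _ _)).symm

/-- Dobrushin-type contraction: if a Markov kernel `K` satisfies
`dTV (K x) (K x') ≤ δ` for all `x, x'`, then binding two probability
measures through `K` contracts total variation by the factor `δ`. -/
theorem stmt_0 {X Y : Type*} [MeasurableSpace X] [MeasurableSpace Y]
    (K : Kernel X Y) [IsMarkovKernel K]
    (δ : ℝ) (hδ0 : 0 ≤ δ) (hδ1 : δ ≤ 1)
    (hK : ∀ x x' : X, dTV (K x) (K x') ≤ δ)
    (μ ν : Measure X) [IsProbabilityMeasure μ] [IsProbabilityMeasure ν] :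
    dTV (μ.bind (fun x => K x)) (ν.bind (fun x => K x)) ≤ δ * dTV μ ν := by
  have : Nonempty {A : Set Y // MeasurableSet A} := ⟨⟨∅, .empty⟩⟩
  refine ciSup_le fun ⟨A, hA⟩ => ?_
  change |(μ.bind (fun x => K x)).real A - (ν.bind (fun x => K x)).real A| ≤ _
  rw [measureReal_bind_kernel K μ hA, measureReal_bind_kernel K ν hA]
  exact abs_integral_sub_le_mul_dTV_of_osc_le μ ν (K.measurable_coe hA).ennreal_toReal
    (fun x x' => (le_abs_self _).trans
      ((abs_measureReal_sub_le_dTV (K x) (K x') hA).trans (hK x x'))) hδ0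
end

section
/- (Theorem 3 of the paper, in standard total variation normalization.) Let Θ₁, Θ₂ be measurable spaces. Let K₂^ε, K₂⁰ be Markov kernels from Θ₁ to Θ₂ and K₁^ε, K₁⁰ be Markov kernels from Θ₂ to Θ₁ (the ABC conditionals with tolerances ε and 0 respectively). Define the Gibbs maps Q_ε ν = (ν.bind K₂^ε).bind K₁^ε and Q₀ ν = (ν.bind K₂⁰).bind K₁⁰ on probability measures on Θ₁. Assume D₀ := sup over θ₁, θ̃₁ of dTV(K₂^ε θ₁, K₂⁰ θ̃₁) < 1, and set D₁ := sup over θ₂ of dTV(K₁^ε θ₂, K₁⁰ θ₂) and D₂ := sup over θ₁ of dTV(K₂^ε θ₁, K₂⁰ θ₁). If ν_ε and ν₀ are probability measures on Θ₁ with Q_ε ν_ε = ν_ε and Q₀ ν₀ = ν₀, then dTV(ν_ε, ν₀) ≤ (D₁ + D₂) / (1 − D₀). -/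
open MeasureTheory ProbabilityTheory

section TotalVariation

variable {X Y : Type*} [MeasurableSpace X] [MeasurableSpace Y]

theorem abs_real_sub_real_le_one (μ ν : Measure X) [IsProbabilityMeasure μ]
    [IsProbabilityMeasure ν] (A : Set X) : |μ.real A - ν.real A| ≤ 1 := by
  have h₁ : μ.real A ≤ 1 := measureReal_le_one
  have h₂ : ν.real A ≤ 1 := measureReal_le_one
  have h₃ : 0 ≤ μ.real A := measureReal_nonneg
  have h₄ : 0 ≤ ν.real A := measureReal_nonneg
  rw [abs_le]
  constructor <;> linarith

theorem dTV_le_one (μ ν : Measure X) [IsProbabilityMeasure μ] [IsProbabilityMeasure ν] :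
    dTV μ ν ≤ 1 :=
  Real.iSup_le (fun A => abs_real_sub_real_le_one μ ν A.1) zero_le_one

theorem dTV_nonneg (μ ν : Measure X) : 0 ≤ dTV μ ν :=
  Real.iSup_nonneg fun _ => abs_nonneg _

theorem dTV_comm (μ ν : Measure X) : dTV μ ν = dTV ν μ := by
  simp only [dTV, abs_sub_comm]

theorem real_sub_real_le_dTV (μ ν : Measure X) [IsProbabilityMeasure μ]
    [IsProbabilityMeasure ν] {A : Set X} (hA : MeasurableSet A) :
    μ.real A - ν.real A ≤ dTV μ ν :=
  (le_abs_self _).trans <| le_ciSup (f := fun A : {A : Set X // MeasurableSet A} =>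
    |(μ A.1).toReal - (ν A.1).toReal|)
    ⟨1, by rintro _ ⟨A, rfl⟩; exact abs_real_sub_real_le_one μ ν A.1⟩ ⟨A, hA⟩

theorem real_bind_kernel (μ : Measure X) (K : Kernel X Y) [IsMarkovKernel K] {B : Set Y}
    (hB : MeasurableSet B) : (μ.bind K).real B = ∫ x, (K x).real B ∂μ := by
  rw [measureReal_def, Measure.bind_apply hB K.aemeasurable]
  exact (integral_toReal (K.measurable_coe hB).aemeasurable
    (.of_forall fun x => measure_lt_top _ _)).symm

theorem integrable_kernel_real (μ : Measure X) [IsFiniteMeasure μ] (K : Kernel X Y)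
    [IsMarkovKernel K] {B : Set Y} (hB : MeasurableSet B) :
    Integrable (fun x => (K x).real B) μ :=
  .of_bound (K.measurable_coe hB).ennreal_toReal.aestronglyMeasurable 1
    (.of_forall fun x => by
      rw [Real.norm_of_nonneg measureReal_nonneg]
      exact measureReal_le_one)

/-- Two probability measures share a common part `m`, and the masses of the remainders
`p` and `q` equal each other and are at most the total variation distance. -/
theorem exists_common_part (μ ν : Measure X) [IsProbabilityMeasure μ]
    [IsProbabilityMeasure ν] :
    ∃ m p q : Measure X, IsFiniteMeasure m ∧ IsFiniteMeasure p ∧ IsFiniteMeasure q ∧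
      μ = m + p ∧ ν = m + q ∧ p.real Set.univ = q.real Set.univ ∧
      p.real Set.univ ≤ dTV μ ν := by
  obtain ⟨S, hS, hνμ, hμν⟩ := hahn_decomposition μ ν
  have h₁ : ν.restrict S ≤ μ.restrict S := Measure.le_iff.2 fun t ht => by
    rw [Measure.restrict_apply ht, Measure.restrict_apply ht]
    exact hνμ _ (ht.inter hS) Set.inter_subset_right
  have h₂ : μ.restrict Sᶜ ≤ ν.restrict Sᶜ := Measure.le_iff.2 fun t ht => by
    rw [Measure.restrict_apply ht, Measure.restrict_apply ht]
    exact hμν _ (ht.inter hS.compl) Set.inter_subset_right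
  have hp := Measure.sub_add_cancel_of_le h₁
  have hq := Measure.sub_add_cancel_of_le h₂
  set p := μ.restrict S - ν.restrict S
  set q := ν.restrict Sᶜ - μ.restrict Sᶜ
  have hμ : μ = ν.restrict S + μ.restrict Sᶜ + p := by
    conv_lhs => rw [← Measure.restrict_add_restrict_compl (μ := μ) hS, ← hp]
    abel
  have hν : ν = ν.restrict S + μ.restrict Sᶜ + q := by
    conv_lhs => rw [← Measure.restrict_add_restrict_compl (μ := ν) hS, ← hq]
    abel
  have hpf : IsFiniteMeasure p := inferInstance
  have hqf : IsFiniteMeasure q := inferInstance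
  have hpS : p.real Set.univ + ν.real S = μ.real S := by
    have := congrArg (fun ρ : Measure X => ρ.real Set.univ) hp
    simpa [measureReal_add_apply] using this
  have hqS : q.real Set.univ + μ.real Sᶜ = ν.real Sᶜ := by
    have := congrArg (fun ρ : Measure X => ρ.real Set.univ) hq
    simpa [measureReal_add_apply] using this
  refine ⟨ν.restrict S + μ.restrict Sᶜ, p, q, inferInstance, hpf, hqf, hμ, hν, ?_, ?_⟩
  · rw [probReal_compl_eq_one_sub hS, probReal_compl_eq_one_sub hS] at hqS
    linarith
  · linarith [real_sub_real_le_dTV μ ν hS]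

theorem real_bind_sub_real_bind_le (K L : Kernel X Y) [IsMarkovKernel K] [IsMarkovKernel L]
    (μ ν : Measure X) [IsProbabilityMeasure μ] [IsProbabilityMeasure ν] {a b : ℝ}
    (ha : ∀ x, dTV (K x) (L x) ≤ a) (hb : ∀ x y, dTV (K x) (L y) ≤ b)
    {B : Set Y} (hB : MeasurableSet B) :
    (μ.bind K).real B - (ν.bind L).real B ≤ a + b * dTV μ ν := by
  obtain ⟨x₀⟩ := μ.nonempty_of_neZero
  have ha0 : 0 ≤ a := (dTV_nonneg _ _).trans (ha x₀)
  have hb0 : 0 ≤ b := (dTV_nonneg _ _).trans (hb x₀ x₀)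
  obtain ⟨m, p, q, _, _, _, hμ, hν, hpq, hp⟩ := exists_common_part μ ν
  have hm : m.real Set.univ ≤ 1 := by
    have h : μ.real Set.univ = m.real Set.univ + p.real Set.univ := by
      rw [hμ, measureReal_add_apply]
    rw [probReal_univ] at h
    linarith [measureReal_nonneg (μ := p) (s := Set.univ)]
  obtain ⟨c, hKc, hLc⟩ : ∃ c, (∀ x, (K x).real B ≤ c) ∧ ∀ y, c - b ≤ (L y).real B := by
    have : Nonempty X := ⟨x₀⟩
    refine ⟨⨆ x, (K x).real B, fun x => le_ciSup (f := fun x => (K x).real B)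
      ⟨1, by rintro _ ⟨x, rfl⟩; exact measureReal_le_one⟩ x, fun y => ?_⟩
    rw [sub_le_iff_le_add]
    exact ciSup_le fun x => by linarith [real_sub_real_le_dTV (K x) (L y) hB, hb x y]
  have hpK : ∫ x, (K x).real B ∂p ≤ p.real Set.univ * c := by
    simpa using integral_mono (integrable_kernel_real p K hB) (integrable_const c) hKc
  have hqL : q.real Set.univ * (c - b) ≤ ∫ x, (L x).real B ∂q := by
    simpa using integral_mono (integrable_const (c - b)) (integrable_kernel_real q L hB) hLc
  have hmKL : ∫ x, (K x).real B ∂m - ∫ x, (L x).real B ∂m ≤ m.real Set.univ * a := by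
    rw [← integral_sub (integrable_kernel_real m K hB) (integrable_kernel_real m L hB)]
    simpa using integral_mono
      ((integrable_kernel_real m K hB).sub (integrable_kernel_real m L hB))
      (integrable_const a) fun x => (real_sub_real_le_dTV (K x) (L x) hB).trans (ha x)
  have hμK : (μ.bind K).real B = ∫ x, (K x).real B ∂m + ∫ x, (K x).real B ∂p := by
    rw [real_bind_kernel μ K hB, hμ]
    exact integral_add_measure (integrable_kernel_real m K hB) (integrable_kernel_real p K hB)
  have hνL : (ν.bind L).real B = ∫ x, (L x).real B ∂m + ∫ x, (L x).real B ∂q := by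
    rw [real_bind_kernel ν L hB, hν]
    exact integral_add_measure (integrable_kernel_real m L hB) (integrable_kernel_real q L hB)
  rw [← hpq] at hqL
  rw [hμK, hνL]
  nlinarith [mul_le_mul_of_nonneg_right hm ha0, mul_le_mul_of_nonneg_left hp hb0]

theorem dTV_bind_le (K L : Kernel X Y) [IsMarkovKernel K] [IsMarkovKernel L]
    (μ ν : Measure X) [IsProbabilityMeasure μ] [IsProbabilityMeasure ν] {a b : ℝ}
    (ha : ∀ x, dTV (K x) (L x) ≤ a) (hb : ∀ x y, dTV (K x) (L y) ≤ b) :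
    dTV (μ.bind K) (ν.bind L) ≤ a + b * dTV μ ν := by
  have : Nonempty {A : Set Y // MeasurableSet A} := ⟨⟨∅, .empty⟩⟩
  refine ciSup_le fun A => abs_sub_le_iff.2
    ⟨real_bind_sub_real_bind_le K L μ ν ha hb A.2, ?_⟩
  rw [dTV_comm μ ν]
  exact real_bind_sub_real_bind_le L K ν μ (fun x => dTV_comm (L x) (K x) ▸ ha x)
    (fun x y => dTV_comm (L x) (K y) ▸ hb y x) A.2

end TotalVariation

/-- Theorem 3 of the paper: comparison of the stationary distributions of the
ABC-Gibbs maps `Qε ν = (ν.bind K₂ε).bind K₁ε` (tolerance ε) and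
`Q₀ ν = (ν.bind K₂⁰).bind K₁⁰` (tolerance 0). With
`D₀ := sup dTV(K₂ε θ₁, K₂⁰ θ̃₁) < 1`, `D₁ := sup dTV(K₁ε θ₂, K₁⁰ θ₂)` and
`D₂ := sup dTV(K₂ε θ₁, K₂⁰ θ₁)`, any fixed points `νε`, `ν₀` satisfy
`dTV(νε, ν₀) ≤ (D₁ + D₂)/(1 − D₀)`. -/
theorem stmt_6 {Θ₁ Θ₂ : Type*} [MeasurableSpace Θ₁] [MeasurableSpace Θ₂]
    (K₂ε K₂0 : Kernel Θ₁ Θ₂) [IsMarkovKernel K₂ε] [IsMarkovKernel K₂0]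
    (K₁ε K₁0 : Kernel Θ₂ Θ₁) [IsMarkovKernel K₁ε] [IsMarkovKernel K₁0]
    (Qε Q0 : Measure Θ₁ → Measure Θ₁)
    (hQε : ∀ ν : Measure Θ₁, Qε ν = (ν.bind (fun t => K₂ε t)).bind (fun t => K₁ε t))
    (hQ0 : ∀ ν : Measure Θ₁, Q0 ν = (ν.bind (fun t => K₂0 t)).bind (fun t => K₁0 t))
    (D₀ D₁ D₂ : ℝ)
    (hD₀ : ∀ θ θ' : Θ₁, dTV (K₂ε θ) (K₂0 θ') ≤ D₀) (hD₀1 : D₀ < 1)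
    (hD₁ : ∀ θ₂ : Θ₂, dTV (K₁ε θ₂) (K₁0 θ₂) ≤ D₁)
    (hD₂ : ∀ θ₁ : Θ₁, dTV (K₂ε θ₁) (K₂0 θ₁) ≤ D₂)
    (νε ν0 : Measure Θ₁) [IsProbabilityMeasure νε] [IsProbabilityMeasure ν0]
    (hνε : Qε νε = νε) (hν0 : Q0 ν0 = ν0) :
    dTV νε ν0 ≤ (D₁ + D₂) / (1 - D₀) := by
  have h₂ : dTV (νε.bind K₂ε) (ν0.bind K₂0) ≤ D₂ + D₀ * dTV νε ν0 :=
    dTV_bind_le K₂ε K₂0 νε ν0 hD₂ hD₀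
  have h₁ : dTV ((νε.bind K₂ε).bind K₁ε) ((ν0.bind K₂0).bind K₁0) ≤
      D₁ + 1 * dTV (νε.bind K₂ε) (ν0.bind K₂0) :=
    dTV_bind_le K₁ε K₁0 _ _ hD₁ fun _ _ => dTV_le_one _ _
  rw [← hQε, ← hQ0, hνε, hν0] at h₁
  rw [le_div_iff₀ (by linarith)]
  linarith
end

section
/- (Proposition 2 of the paper.) Let (Θ₁, λ₁) and (Θ₂, λ₂) be σ-finite measure spaces and (𝒳, λ_x) a σ-finite measure space of data. Let π₁, π₂ be probability densities on Θ₁ and Θ₂ with respect to λ₁ and λ₂ (so the prior factorizes, π(θ₁, θ₂) = π₁(θ₁)π₂(θ₂)), let f : Θ₁ × Θ₂ × 𝒳 → [0,∞) be a measurable likelihood density with ∫ f(θ₁, θ₂, x) dλ_x(x) = 1 for all (θ₁, θ₂), and let W ⊆ 𝒳 be a measurable acceptance event (W = {x : d(s(x), s(x*)) ≤ ε} with a common summary statistic s₁ = s₂ = s and common tolerance ε). Set F(θ₁, θ₂) = ∫_W f(θ₁, θ₂, x) dλ_x(x), and assume 0 < ∫∫ π₁ π₂ F dλ₁ dλ₂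 < ∞, with 0 < ∫ π₁(t₁) F(t₁, θ₂) dλ₁(t₁) < ∞ for every θ₂ and 0 < ∫ π₂(t₂) F(θ₁, t₂) dλ₂(t₂) < ∞ for every θ₁. Define the ABC-Gibbs transition on Θ₁ × Θ₂ which first redraws θ₁ from the density proportional to π₁(·) F(·, θ₂) and then redraws θ₂ from the density proportional to π₂(·) F(θ₁, ·). Then the probability measure with density proportional to π₁(θ₁) π₂(θ₂) F(θ₁, θ₂) — the vanilla ABC limiting distribution with statistic s and tolerance ε — is invariant for this ABC-Gibbs transition; hence, under the contraction assumptions of Theorems 1 and 3, ABC-Gibbs and vanilla ABC have the same limiting distribution. -/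
open MeasureTheory

/-- Multiplying the expectation under the normalized density `g` by the normalizing constant
gives back the integral against `g`. -/
theorem lintegral_density_mul_lintegral_normalized {α : Type*} [MeasurableSpace α]
    (μ : Measure α) {g : α → ENNReal} (hg : Measurable g)
    (hpos : 0 < ∫⁻ t, g t ∂μ) (hfin : ∫⁻ t, g t ∂μ < ⊤)
    {u : α → ENNReal} (hu : Measurable u) :
    (∫⁻ t, g t ∂μ) * ∫⁻ t, u t ∂((∫⁻ t, g t ∂μ)⁻¹ • μ.withDensity g) =
      ∫⁻ t, g t * u t ∂μ := by
  rw [lintegral_smul_measure, lintegral_withDensity_eq_lintegral_mul _ hg hu, smul_eq_mul,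
    ← mul_assoc, ENNReal.mul_inv_cancel hpos.ne' hfin.ne, one_mul]
  rfl

/-- The normalized measures attached to a jointly measurable density depend measurably on the
parameter. -/
theorem measurable_normalized_withDensity {α β : Type*} [MeasurableSpace α] [MeasurableSpace β]
    (ν : Measure β) [SFinite ν] {g : α → β → ENNReal} (hg : Measurable (Function.uncurry g)) :
    Measurable (fun a => (∫⁻ t, g a t ∂ν)⁻¹ • ν.withDensity (g a)) := by
  refine Measure.measurable_of_measurable_coe _ fun s hs => ?_
  simp only [Measure.smul_apply, withDensity_apply _ hs, smul_eq_mul]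
  exact (hg.lintegral_prod_right' (ν := ν)).inv.mul
    (hg.lintegral_prod_right' (ν := ν.restrict s))

/-- Proposition 2 of the paper.  For a factorized prior `π₁ ⊗ π₂`, a likelihood
`f` and a common acceptance event `W` (common summary statistic and tolerance
for both components), the vanilla-ABC limiting distribution, with density
proportional to `π₁(θ₁) π₂(θ₂) F(θ₁, θ₂)` where `F(θ₁, θ₂) = ∫_W f(θ₁, θ₂, x)`,
is invariant for the ABC-Gibbs transition which first redraws `θ₁` from the
density proportional to `π₁(·) F(·, θ₂)` and then redraws `θ₂` from the density
proportional to `π₂(·) F(θ₁, ·)`; hence ABC-Gibbs and vanilla ABC share the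
same limiting distribution. -/
theorem stmt_13 {Θ₁ Θ₂ X : Type*} [MeasurableSpace Θ₁] [MeasurableSpace Θ₂]
    [MeasurableSpace X]
    (l₁ : Measure Θ₁) (l₂ : Measure Θ₂) (lx : Measure X)
    [SigmaFinite l₁] [SigmaFinite l₂] [SigmaFinite lx]
    (π₁ : Θ₁ → ℝ) (π₂ : Θ₂ → ℝ)
    (hπ₁0 : ∀ t, 0 ≤ π₁ t) (hπ₂0 : ∀ t, 0 ≤ π₂ t)
    (hπ₁m : Measurable π₁) (hπ₂m : Measurable π₂)
    (hπ₁1 : ∫ t, π₁ t ∂l₁ = 1) (hπ₂1 : ∫ t, π₂ t ∂l₂ = 1)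
    (f : Θ₁ → Θ₂ → X → ℝ) (hf0 : ∀ a b x, 0 ≤ f a b x)
    (hfm : Measurable (fun p : (Θ₁ × Θ₂) × X => f p.1.1 p.1.2 p.2))
    (hf1 : ∀ a b, ∫ x, f a b x ∂lx = 1)
    (W : Set X) (hW : MeasurableSet W)
    (F : Θ₁ → Θ₂ → ℝ) (hF : ∀ a b, F a b = ∫ x in W, f a b x ∂lx)
    (Z : ℝ) (hZdef : Z = ∫ a, ∫ b, π₁ a * π₂ b * F a b ∂l₂ ∂l₁) (hZpos : 0 < Z)
    (hZint : Integrable (fun p : Θ₁ × Θ₂ => π₁ p.1 * π₂ p.2 * F p.1 p.2)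
      (l₁.prod l₂))
    (c₁ : Θ₂ → Measure Θ₁)
    (hc₁ : ∀ b, c₁ b = (∫⁻ t, ENNReal.ofReal (π₁ t * F t b) ∂l₁)⁻¹ •
      l₁.withDensity (fun t => ENNReal.ofReal (π₁ t * F t b)))
    (hc₁pos : ∀ b, 0 < ∫⁻ t, ENNReal.ofReal (π₁ t * F t b) ∂l₁)
    (hc₁fin : ∀ b, ∫⁻ t, ENNReal.ofReal (π₁ t * F t b) ∂l₁ < ⊤)
    (c₂ : Θ₁ → Measure Θ₂)
    (hc₂ : ∀ a, c₂ a = (∫⁻ t, ENNReal.ofReal (π₂ t * F a t) ∂l₂)⁻¹ •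
      l₂.withDensity (fun t => ENNReal.ofReal (π₂ t * F a t)))
    (hc₂pos : ∀ a, 0 < ∫⁻ t, ENNReal.ofReal (π₂ t * F a t) ∂l₂)
    (hc₂fin : ∀ a, ∫⁻ t, ENNReal.ofReal (π₂ t * F a t) ∂l₂ < ⊤)
    (μstar : Measure (Θ₁ × Θ₂))
    (hμstar : μstar = (l₁.prod l₂).withDensity
      (fun p => ENNReal.ofReal (π₁ p.1 * π₂ p.2 * F p.1 p.2 / Z)))
    (T : Measure (Θ₁ × Θ₂) → Measure (Θ₁ × Θ₂))
    (hT : ∀ ν : Measure (Θ₁ × Θ₂), T ν = ν.bind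
      (fun p => (c₁ p.2).bind (fun a => (c₂ a).map (fun b => (a, b))))) :
    T μstar = μstar := by
  have hFm : Measurable (fun p : Θ₁ × Θ₂ => F p.1 p.2) := by
    simp only [hF]
    exact (hfm.stronglyMeasurable.integral_prod_right' (ν := lx.restrict W)).measurable
  have hg₁ : Measurable (Function.uncurry fun b a => ENNReal.ofReal (π₁ a * F a b)) :=
    ((hπ₁m.comp measurable_snd).mul (hFm.comp measurable_swap)).ennreal_ofReal
  have hg₂ : Measurable (Function.uncurry fun a b => ENNReal.ofReal (π₂ b * F a b)) :=
    ((hπ₂m.comp measurable_snd).mul hFm).ennreal_ofReal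
  have hw : Measurable
      (fun p : Θ₁ × Θ₂ => ENNReal.ofReal (π₁ p.1 * π₂ p.2 * F p.1 p.2 / Z)) :=
    ((((hπ₁m.comp measurable_fst).mul (hπ₂m.comp measurable_snd)).mul hFm).div_const
      Z).ennreal_ofReal
  have hw₁ : ∀ a b, ENNReal.ofReal (π₁ a * π₂ b * F a b / Z) =
      ENNReal.ofReal (π₂ b / Z) * ENNReal.ofReal (π₁ a * F a b) := fun a b => by
    rw [← ENNReal.ofReal_mul (div_nonneg (hπ₂0 b) hZpos.le)]
    congr 1
    ring
  have hw₂ : ∀ a b, ENNReal.ofReal (π₁ a * π₂ b * F a b / Z) =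
      ENNReal.ofReal (π₁ a / Z) * ENNReal.ofReal (π₂ b * F a b) := fun a b => by
    rw [← ENNReal.ofReal_mul (div_nonneg (hπ₁0 a) hZpos.le)]
    congr 1
    ring
  have hc₁m : Measurable c₁ := by
    rw [funext hc₁]
    exact measurable_normalized_withDensity l₁ hg₁
  have hc₂m : Measurable c₂ := by
    rw [funext hc₂]
    exact measurable_normalized_withDensity l₂ hg₂
  have hc₂prob : ∀ a, IsProbabilityMeasure (c₂ a) := fun a => ⟨by
    rw [hc₂, Measure.smul_apply, withDensity_apply _ MeasurableSet.univ, Measure.restrict_univ,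
      smul_eq_mul, ENNReal.inv_mul_cancel (hc₂pos a).ne' (hc₂fin a).ne]⟩
  let κ : ProbabilityTheory.Kernel Θ₁ Θ₂ := ⟨c₂, hc₂m⟩
  have hκ : ProbabilityTheory.IsMarkovKernel κ := ⟨hc₂prob⟩
  have hmap : Measurable (fun a => (c₂ a).map (fun b => (a, b))) := by
    refine Measure.measurable_of_measurable_coe _ fun s hs => ?_
    simp only [Measure.map_apply measurable_prodMk_left hs]
    exact ProbabilityTheory.Kernel.measurable_kernel_prodMk_left (κ := κ) hs
  have hbind : Measurable
      (fun p : Θ₁ × Θ₂ => (c₁ p.2).bind (fun a => (c₂ a).map (fun b => (a, b)))) :=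
    (Measure.measurable_bind' hmap).comp (hc₁m.comp measurable_snd)
  rw [hT]
  ext s hs
  have hφ : Measurable (fun a => c₂ a (Prod.mk a ⁻¹' s)) :=
    ProbabilityTheory.Kernel.measurable_kernel_prodMk_left (κ := κ) hs
  have hψ : Measurable (fun b => ∫⁻ a, c₂ a (Prod.mk a ⁻¹' s) ∂(c₁ b)) :=
    (Measure.measurable_lintegral hφ).comp hc₁m
  rw [Measure.bind_apply hs hbind.aemeasurable]
  simp only [Measure.bind_apply hs hmap.aemeasurable, Measure.map_apply measurable_prodMk_left hs]
  have hfirst : ∀ b, ∫⁻ a, ENNReal.ofReal (π₁ a * π₂ b * F a b / Z) *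
        ∫⁻ a', c₂ a' (Prod.mk a' ⁻¹' s) ∂(c₁ b) ∂l₁ =
      ∫⁻ a, ENNReal.ofReal (π₁ a * π₂ b * F a b / Z) * c₂ a (Prod.mk a ⁻¹' s) ∂l₁ := fun b => by
    have hgb : Measurable fun a => ENNReal.ofReal (π₁ a * F a b) :=
      hg₁.comp measurable_prodMk_left
    simp only [hw₁]
    simp only [mul_assoc (ENNReal.ofReal (π₂ b / Z))]
    rw [lintegral_const_mul' _ _ ENNReal.ofReal_ne_top,
      lintegral_const_mul' _ _ ENNReal.ofReal_ne_top,
      lintegral_mul_const _ hgb, hc₁,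
      lintegral_density_mul_lintegral_normalized l₁ hgb (hc₁pos b) (hc₁fin b) hφ]
  have hsecond : ∀ a, ∫⁻ b, ENNReal.ofReal (π₁ a * π₂ b * F a b / Z) *
        c₂ a (Prod.mk a ⁻¹' s) ∂l₂ =
      ∫⁻ b, ENNReal.ofReal (π₁ a * π₂ b * F a b / Z) *
        s.indicator (fun _ => 1) (a, b) ∂l₂ := fun a => by
    have hga : Measurable fun b => ENNReal.ofReal (π₂ b * F a b) :=
      hg₂.comp measurable_prodMk_left
    have hind : Measurable fun b => s.indicator (fun _ => (1 : ENNReal)) (a, b) :=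
      (measurable_const.indicator hs).comp measurable_prodMk_left
    have hval : c₂ a (Prod.mk a ⁻¹' s) =
        ∫⁻ b, s.indicator (fun _ => (1 : ENNReal)) (a, b) ∂(c₂ a) :=
      (lintegral_indicator_one (measurable_prodMk_left hs)).symm
    simp only [hw₂]
    simp only [mul_assoc (ENNReal.ofReal (π₁ a / Z))]
    rw [lintegral_const_mul' _ _ ENNReal.ofReal_ne_top,
      lintegral_const_mul' _ _ ENNReal.ofReal_ne_top,
      lintegral_mul_const _ hga, hval, hc₂,
      lintegral_density_mul_lintegral_normalized l₂ hga (hc₂pos a) (hc₂fin a) hind]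
  have hone : Measurable (s.indicator (fun _ => (1 : ENNReal))) := measurable_const.indicator hs
  calc ∫⁻ p, ∫⁻ a, c₂ a (Prod.mk a ⁻¹' s) ∂(c₁ p.2) ∂μstar
      = ∫⁻ p, ENNReal.ofReal (π₁ p.1 * π₂ p.2 * F p.1 p.2 / Z) *
          ∫⁻ a, c₂ a (Prod.mk a ⁻¹' s) ∂(c₁ p.2) ∂(l₁.prod l₂) := by
        rw [hμstar]
        exact lintegral_withDensity_eq_lintegral_mul _ hw (hψ.comp measurable_snd)
    _ = ∫⁻ p, ENNReal.ofReal (π₁ p.1 * π₂ p.2 * F p.1 p.2 / Z) *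
          c₂ p.1 (Prod.mk p.1 ⁻¹' s) ∂(l₁.prod l₂) := by
        exact (lintegral_prod_symm' _ (hw.mul (hψ.comp measurable_snd))).trans
          ((lintegral_congr hfirst).trans
            (lintegral_prod_symm' _ (hw.mul (hφ.comp measurable_fst))).symm)
    _ = ∫⁻ p, ENNReal.ofReal (π₁ p.1 * π₂ p.2 * F p.1 p.2 / Z) *
          s.indicator (fun _ => 1) p ∂(l₁.prod l₂) := by
        exact (lintegral_prod _ (hw.mul (hφ.comp measurable_fst)).aemeasurable).trans
          ((lintegral_congr hsecond).trans (lintegral_prod _ (hw.mul hone).aemeasurable).symm)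
    _ = ∫⁻ p, s.indicator (fun _ => 1) p ∂μstar := by
        rw [hμstar]
        exact (lintegral_withDensity_eq_lintegral_mul _ hw hone).symm
    _ = μstar s := lintegral_indicator_one hs
end

section
/- (Counter-example of Section 8 of the supplementary material.) Consider the prior uniform on 𝒜 = {(θ₁, θ₂) ∈ [0,10]² : |θ₁ − θ₂| > 2}, the likelihood density f(x | θ₁, θ₂) = (1/2)·1_{[θ₁, θ₁+1]}(x) + (1/2)·1_{[θ₂, θ₂+1]}(x) with respect to Lebesgue measure on ℝ, the observation x* = 5 and tolerance ε = 1/2 with summary statistic the identity, so that the acceptance event is W = (4.5, 5.5). For θ₁ ∈ [0,10], let ν_{θ₁} be the ABC conditional distribution of θ₂, namely the probability measure on [0,10] with density proportional to 1_𝒜(θ₁, θ₂) · ∫_{4.5}^{5.5} f(x | θ₁, θ₂) dx (these normalizing constants are finite and strictly positive for θ₁ = 1 and θ₁ = 5). Then ν₁ is supported in [3.5, 5.5] (ν₁([3.5, 5.5]) = 1) while ν₅ is supported in [0, 3) ∪ (7, 10] (ν₅([0,3) ∪ (7,10]) = 1); these supports are disjoint, so dTV(ν₁, ν₅) = 1.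 In particular the hypothesis of Theorem 1 of the paper, sup over θ₁, θ̃₁ of dTV(ν_{θ₁}, ν_{θ̃₁}) < 1, fails for this model. -/
open MeasureTheory Classical

/-- The prior support: `{(θ₁, θ₂) ∈ [0,10]² : |θ₁ − θ₂| > 2}`. -/
def Adom : Set (ℝ × ℝ) :=
  {p | p.1 ∈ Set.Icc (0 : ℝ) 10 ∧ p.2 ∈ Set.Icc (0 : ℝ) 10 ∧ 2 < |p.1 - p.2|}

/-- The likelihood density of the mixture
`(1/2)·𝟙_{[θ₁, θ₁+1]}(x) + (1/2)·𝟙_{[θ₂, θ₂+1]}(x)`. -/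
noncomputable def fmix (θ₁ θ₂ x : ℝ) : ℝ :=
  (1 / 2) * Set.indicator (Set.Icc θ₁ (θ₁ + 1)) (fun _ => (1 : ℝ)) x
    + (1 / 2) * Set.indicator (Set.Icc θ₂ (θ₂ + 1)) (fun _ => (1 : ℝ)) x

/-- Acceptance probability `∫_{4.5}^{5.5} f(x | θ₁, θ₂) dx` with acceptance
event `W = (4.5, 5.5)` (observation `x* = 5`, tolerance `ε = 1/2`). -/
noncomputable def gacc (θ₁ θ₂ : ℝ) : ℝ :=
  ∫ x in Set.Ioo (4.5 : ℝ) 5.5, fmix θ₁ θ₂ x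

/-- Unnormalized density of the ABC conditional of `θ₂` given `θ₁`. -/
noncomputable def densCond (θ₁ θ₂ : ℝ) : ℝ :=
  if (θ₁, θ₂) ∈ Adom then gacc θ₁ θ₂ else 0

/-- Normalizing constant of the ABC conditional of `θ₂` given `θ₁`. -/
noncomputable def normConst (θ₁ : ℝ) : ENNReal :=
  ∫⁻ θ₂, ENNReal.ofReal (densCond θ₁ θ₂)

/-- The ABC conditional distribution `ν_{θ₁}` of `θ₂` given `θ₁`: the measure
with density proportional to `1_𝒜(θ₁, θ₂) · ∫_{4.5}^{5.5} f(x | θ₁, θ₂) dx`. -/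
noncomputable def νcond (θ₁ : ℝ) : Measure ℝ :=
  (normConst θ₁)⁻¹ • volume.withDensity (fun θ₂ => ENNReal.ofReal (densCond θ₁ θ₂))

/-- The length of `[t, t + 1] ∩ (4.5, 5.5)`. -/
noncomputable def overlap (t : ℝ) : ℝ := max (min (t + 1) 5.5 - max t 4.5) 0

lemma setIntegral_indicator_Icc_eq_overlap (t : ℝ) :
    ∫ x in Set.Ioo (4.5 : ℝ) 5.5, Set.indicator (Set.Icc t (t + 1)) (fun _ => (1 : ℝ)) x
      = overlap t := by
  rw [integral_indicator_const _ measurableSet_Icc, measureReal_def,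
    Measure.restrict_congr_set Ioo_ae_eq_Icc, Measure.restrict_apply measurableSet_Icc,
    Set.Icc_inter_Icc, Real.volume_Icc, ENNReal.toReal_ofReal']
  simp [overlap]

lemma integrableOn_indicator_Icc (t : ℝ) :
    IntegrableOn (Set.indicator (Set.Icc t (t + 1)) (fun _ => (1 : ℝ))) (Set.Ioo (4.5 : ℝ) 5.5) :=
  ((integrable_indicator_iff measurableSet_Icc).2
    (integrableOn_const (by simp) (by simp))).integrableOn

lemma gacc_eq_overlap (θ₁ θ₂ : ℝ) : gacc θ₁ θ₂ = 1 / 2 * overlap θ₁ + 1 / 2 * overlap θ₂ := by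
  unfold gacc fmix
  rw [integral_add ((integrableOn_indicator_Icc θ₁).const_mul _)
      ((integrableOn_indicator_Icc θ₂).const_mul _),
    integral_const_mul, integral_const_mul, setIntegral_indicator_Icc_eq_overlap,
    setIntegral_indicator_Icc_eq_overlap]

lemma overlap_nonneg (t : ℝ) : 0 ≤ overlap t := le_max_right _ _

lemma overlap_le_one (t : ℝ) : overlap t ≤ 1 := by
  refine max_le ?_ zero_le_one
  linarith [min_le_left (t + 1) 5.5, le_max_left t 4.5]

lemma overlap_eq_zero_of_le {t : ℝ} (ht : t ≤ 3.5) : overlap t = 0 := by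
  refine max_eq_right ?_
  linarith [min_le_left (t + 1) 5.5, le_max_right t 4.5]

lemma overlap_eq_zero_of_ge {t : ℝ} (ht : 5.5 ≤ t) : overlap t = 0 := by
  refine max_eq_right ?_
  linarith [min_le_right (t + 1) 5.5, le_max_left t 4.5]

lemma half_le_overlap {t : ℝ} (h₁ : 4 ≤ t) (h₂ : t ≤ 5) : 1 / 2 ≤ overlap t := by
  refine le_max_of_le_left ?_
  rcases le_total t 4.5 with h | h
  · rw [max_eq_right h, min_eq_left (by linarith)]
    linarith
  · rw [max_eq_left h, min_eq_right (by linarith)]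
    linarith

lemma normConst_lt_top (θ₁ : ℝ) : normConst θ₁ < ⊤ := by
  have hle : normConst θ₁ ≤ ∫⁻ θ₂, Set.indicator (Set.Icc (0 : ℝ) 10) (fun _ => 1) θ₂ := by
    refine lintegral_mono fun θ₂ => ?_
    by_cases h : (θ₁, θ₂) ∈ Adom
    · rw [Set.indicator_of_mem h.2.1, densCond, if_pos h, gacc_eq_overlap]
      exact ENNReal.ofReal_le_one.2 (by linarith [overlap_le_one θ₁, overlap_le_one θ₂])
    · simp [densCond, h]
  refine hle.trans_lt ?_
  rw [lintegral_indicator_const measurableSet_Icc, Real.volume_Icc, one_mul]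
  exact ENNReal.ofReal_lt_top

lemma normConst_pos {θ₁ a b c : ℝ} (hab : a < b) (hc : 0 < c)
    (h : ∀ θ₂ ∈ Set.Ioo a b, c ≤ densCond θ₁ θ₂) : 0 < normConst θ₁ := by
  have hle : ∫⁻ θ₂, Set.indicator (Set.Ioo a b) (fun _ => ENNReal.ofReal c) θ₂ ≤ normConst θ₁ :=
    lintegral_mono fun θ₂ =>
      Set.indicator_le (fun x hx => ENNReal.ofReal_le_ofReal (h x hx)) θ₂
  refine lt_of_lt_of_le ?_ hle
  rw [lintegral_indicator_const measurableSet_Ioo, Real.volume_Ioo]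
  exact ENNReal.mul_pos (ENNReal.ofReal_pos.2 hc).ne' (ENNReal.ofReal_pos.2 (sub_pos.2 hab)).ne'

lemma νcond_apply_eq_one {θ₁ : ℝ} (h₀ : 0 < normConst θ₁) {S : Set ℝ} (hS : MeasurableSet S)
    (h : ∀ θ₂ ∉ S, densCond θ₁ θ₂ = 0) : νcond θ₁ S = 1 := by
  have hint : ∫⁻ θ₂ in S, ENNReal.ofReal (densCond θ₁ θ₂) = normConst θ₁ := by
    rw [← lintegral_indicator hS, Set.indicator_eq_self.2, normConst]
    intro x hx
    by_contra hxS
    exact hx (by simp [h x hxS])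
  rw [νcond, Measure.smul_apply, withDensity_apply _ hS, hint, smul_eq_mul,
    ENNReal.inv_mul_cancel h₀.ne' (normConst_lt_top θ₁).ne]

lemma isProbabilityMeasure_νcond {θ₁ : ℝ} (h₀ : 0 < normConst θ₁) :
    IsProbabilityMeasure (νcond θ₁) :=
  ⟨νcond_apply_eq_one h₀ MeasurableSet.univ fun _ h => absurd (Set.mem_univ _) h⟩

/-- Probability measures concentrated on disjoint sets are at total variation distance one. -/
lemma dTV_eq_one_of_disjoint {X : Type*} [MeasurableSpace X] {μ ν : Measure X}
    [IsProbabilityMeasure μ] [IsProbabilityMeasure ν] {S T : Set X} (hS : MeasurableSet S)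
    (hST : Disjoint S T) (hμ : μ S = 1) (hT : MeasurableSet T) (hν : ν T = 1) :
    dTV μ ν = 1 := by
  have hle (A : {A : Set X // MeasurableSet A}) :
      |(μ A.1).toReal - (ν A.1).toReal| ≤ 1 := by
    have h₁ : (μ A.1).toReal ≤ 1 := measureReal_le_one
    have h₂ : (ν A.1).toReal ≤ 1 := measureReal_le_one
    have h₃ : 0 ≤ (μ A.1).toReal := ENNReal.toReal_nonneg
    have h₄ : 0 ≤ (ν A.1).toReal := ENNReal.toReal_nonneg
    exact abs_le.2 ⟨by linarith, by linarith⟩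
  have : Nonempty {A : Set X // MeasurableSet A} := ⟨⟨S, hS⟩⟩
  refine le_antisymm (ciSup_le hle) ?_
  have hνS : ν S = 0 :=
    measure_mono_null hST.subset_compl_right ((prob_compl_eq_zero_iff hT).2 hν)
  have hsup := le_ciSup (f := fun A : {A : Set X // MeasurableSet A} =>
    |(μ A.1).toReal - (ν A.1).toReal|) ⟨1, Set.forall_mem_range.2 hle⟩ ⟨S, hS⟩
  simpa [dTV, hμ, hνS] using hsup

lemma normConst_one_pos : 0 < normConst 1 := by
  refine normConst_pos (a := 4) (b := 5) (c := 1 / 4) (by norm_num) (by norm_num) ?_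
  rintro θ₂ ⟨h₁, h₂⟩
  have hA : ((1 : ℝ), θ₂) ∈ Adom :=
    ⟨by norm_num, ⟨by linarith, by linarith⟩, lt_abs.2 (Or.inr (by linarith))⟩
  rw [densCond, if_pos hA, gacc_eq_overlap]
  linarith [half_le_overlap h₁.le h₂.le, overlap_nonneg 1]

lemma normConst_five_pos : 0 < normConst 5 := by
  refine normConst_pos (a := 0) (b := 3) (c := 1 / 4) (by norm_num) (by norm_num) ?_
  rintro θ₂ ⟨h₁, h₂⟩
  have hA : ((5 : ℝ), θ₂) ∈ Adom :=
    ⟨by norm_num, ⟨by linarith, by linarith⟩, lt_abs.2 (Or.inl (by linarith))⟩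
  rw [densCond, if_pos hA, gacc_eq_overlap]
  linarith [half_le_overlap (t := 5) (by norm_num) le_rfl, overlap_nonneg θ₂]

lemma νcond_one_support : νcond 1 (Set.Icc (3.5 : ℝ) 5.5) = 1 := by
  refine νcond_apply_eq_one normConst_one_pos measurableSet_Icc fun θ₂ h => ?_
  have h₂ : overlap θ₂ = 0 := by
    rcases le_total θ₂ 3.5 with h' | h'
    · exact overlap_eq_zero_of_le h'
    · exact overlap_eq_zero_of_ge (le_of_not_ge fun h'' => h ⟨h', h''⟩)
  simp [densCond, gacc_eq_overlap, h₂, overlap_eq_zero_of_le (t := 1) (by norm_num)]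

lemma νcond_five_support : νcond 5 (Set.Ico (0 : ℝ) 3 ∪ Set.Ioc (7 : ℝ) 10) = 1 := by
  refine νcond_apply_eq_one normConst_five_pos (measurableSet_Ico.union measurableSet_Ioc)
    fun θ₂ h => if_neg ?_
  rintro ⟨-, ⟨h₀, h₁⟩, h₂⟩
  rcases lt_abs.1 h₂ with h₂ | h₂
  · exact h (Or.inl ⟨h₀, by linarith⟩)
  · exact h (Or.inr ⟨by linarith, h₁⟩)

lemma dTV_νcond_one_five : dTV (νcond 1) (νcond 5) = 1 := by
  have := isProbabilityMeasure_νcond normConst_one_pos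
  have := isProbabilityMeasure_νcond normConst_five_pos
  refine dTV_eq_one_of_disjoint measurableSet_Icc ?_ νcond_one_support
    (measurableSet_Ico.union measurableSet_Ioc) νcond_five_support
  rw [Set.disjoint_left]
  rintro x ⟨h₁, h₂⟩ (⟨-, h⟩ | ⟨h, -⟩)
  · norm_num at h₁
    linarith
  · norm_num at h₂
    linarith

/-- Counter-example of Section 8 of the supplementary material: the normalizing
constants at `θ₁ = 1` and `θ₁ = 5` are finite and strictly positive, `ν₁` is
supported in `[3.5, 5.5]`, `ν₅` is supported in `[0, 3) ∪ (7, 10]`, and since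
these supports are disjoint `dTV(ν₁, ν₅) = 1`; in particular the hypothesis of
Theorem 1 of the paper fails for this model. -/
theorem stmt_14 :
    0 < normConst 1 ∧ normConst 1 < ⊤ ∧
    0 < normConst 5 ∧ normConst 5 < ⊤ ∧
    νcond 1 (Set.Icc (3.5 : ℝ) 5.5) = 1 ∧
    νcond 5 (Set.Ico (0 : ℝ) 3 ∪ Set.Ioc (7 : ℝ) 10) = 1 ∧
    dTV (νcond 1) (νcond 5) = 1 ∧
    ¬ (∃ κ : ℝ, κ < 1 ∧ ∀ θ₁ θ₁' : ℝ, θ₁ ∈ Set.Icc (0:ℝ) 10 →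
        θ₁' ∈ Set.Icc (0:ℝ) 10 → dTV (νcond θ₁) (νcond θ₁') ≤ κ) := by
  refine ⟨normConst_one_pos, normConst_lt_top 1, normConst_five_pos, normConst_lt_top 5,
    νcond_one_support, νcond_five_support, dTV_νcond_one_five, ?_⟩
  rintro ⟨κ, hκ, h⟩
  have h₁₅ := h 1 5 (by norm_num) (by norm_num)
  rw [dTV_νcond_one_five] at h₁₅
  linarith
end
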